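/- For every positive integer n, there are infinitely many positive integers x such that Ω(x) = Ω(x + n), where Ω(x) denotes the number of prime factors of x counted with multiplicity. -/

import Mathlib

open ArithmeticFunction

/-- There are arbitrarily large finite sets in which each difference divides its smaller term. -/
theorem exists_finset_sub_dvd (k : ℕ) (hk : 1 ≤ k) :
    ∃ s : Finset ℕ, s.card = k ∧ (∀ a ∈ s, 2 ≤ a) ∧
      (∀ a ∈ s, ∀ b ∈ s, a < b → b - a ∣ a) ∧ ∏ a ∈ s, a ≤ 2 ^ (2 ^ k * k.factorial) := by
  induction k, hk using Nat.le_induction with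
  | base => exact ⟨{2}, by simp, by simp, by simp, by simp⟩
  | succ k hk ih =>
    obtain ⟨s, hcard, h2, hdvd, hprod⟩ := ih
    set A := ∏ a ∈ s, a with hA
    set E := 2 ^ k * k.factorial with hE
    have hE1 : 1 ≤ E := Nat.one_le_iff_ne_zero.2 (by positivity)
    have hdA : ∀ a ∈ s, a ∣ A := fun a ha => Finset.dvd_prod_of_mem _ ha
    have hApos : 0 < A := Finset.prod_pos fun a ha => by have := h2 a ha; omega
    have hleA : ∀ a ∈ s, a ≤ A := fun a ha => Nat.le_of_dvd hApos (hdA a ha)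
    have hA2 : 2 ≤ A := by
      obtain ⟨a, ha⟩ : s.Nonempty := Finset.card_pos.1 (by omega)
      exact (h2 a ha).trans (hleA a ha)
    have hnot : A ∉ s.map (addLeftEmbedding A) := by
      simp only [Finset.mem_map, addLeftEmbedding_apply, not_exists, not_and]
      intro a ha h
      have := h2 a ha
      omega
    refine ⟨insert A (s.map (addLeftEmbedding A)), ?_, ?_, ?_, ?_⟩
    · rw [Finset.card_insert_of_notMem hnot, Finset.card_map, hcard]
    · simp only [Finset.mem_insert, Finset.mem_map, addLeftEmbedding_apply]
      rintro _ (rfl | ⟨a, -, rfl⟩) <;> omega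
    · simp only [Finset.mem_insert, Finset.mem_map, addLeftEmbedding_apply]
      rintro _ (rfl | ⟨a, ha, rfl⟩) _ (rfl | ⟨b, hb, rfl⟩) hab
      · omega
      · simpa using hdA b hb
      · omega
      · have h := hdvd a ha b hb (by omega)
        rw [Nat.add_sub_add_left]
        exact (h.trans (hdA a ha)).add h
    · rw [Finset.prod_insert hnot, Finset.prod_map]
      calc A * ∏ a ∈ s, addLeftEmbedding A a ≤ A * ∏ _a ∈ s, (2 * A) := by
            gcongr with a ha
            have := hleA a ha
            simp only [addLeftEmbedding_apply]
            omega
        _ = A * (2 * A) ^ k := by rw [Finset.prod_const, hcard]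
        _ ≤ 2 ^ E * (2 * 2 ^ E) ^ k := by gcongr
        _ = 2 ^ (E + (E + 1) * k) := by rw [← pow_succ', ← pow_mul, ← pow_add]
        _ ≤ 2 ^ (2 ^ (k + 1) * (k + 1).factorial) := by
            apply Nat.pow_le_pow_right (by norm_num)
            have : 2 ^ (k + 1) * (k + 1).factorial = E * (2 * (k + 1)) := by
              rw [hE, Nat.factorial_succ]; ring
            rw [this]
            nlinarith

theorem exists_injOn_primes (s : Finset ℕ) (P : ℕ) (hP : 0 < P) :
    ∃ q : ℕ → ℕ, Set.InjOn q s ∧ ∀ a ∈ s, (q a).Prime ∧ P < q a ∧ q a ≤ 2 ^ s.card * P := by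
  induction s using Finset.induction_on with
  | empty => exact ⟨id, by simp, by simp⟩
  | insert a s ha ih =>
    obtain ⟨q, hinj, hq⟩ := ih
    obtain ⟨p, hp, hlt, hle⟩ := Nat.exists_prime_lt_and_le_two_mul (2 ^ s.card * P) (by positivity)
    have hPle : P ≤ 2 ^ s.card * P := Nat.le_mul_of_pos_left _ (by positivity)
    have hne : ∀ b ∈ s, b ≠ a := fun b hb h => ha (h ▸ hb)
    refine ⟨Function.update q a p, ?_, ?_⟩
    · intro b hb c hc h
      simp only [Finset.coe_insert, Set.mem_insert_iff, Finset.mem_coe] at hb hc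
      rcases hb with rfl | hb <;> rcases hc with rfl | hc
      · rfl
      · rw [Function.update_self, Function.update_of_ne (hne c hc)] at h
        have := (hq c hc).2.2
        omega
      · rw [Function.update_self, Function.update_of_ne (hne b hb)] at h
        have := (hq b hb).2.2
        omega
      · rw [Function.update_of_ne (hne c hc), Function.update_of_ne (hne b hb)] at h
        exact hinj hb hc h
    · intro b hb
      rw [Finset.card_insert_of_notMem ha, pow_succ']
      rcases Finset.mem_insert.1 hb with rfl | hb
      · rw [Function.update_self]
        exact ⟨hp, by omega, by rw [mul_assoc]; exact hle⟩
      · rw [Function.update_of_ne (hne b hb)]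
        obtain ⟨h1, h2, h3⟩ := hq b hb
        exact ⟨h1, h2, h3.trans (by rw [mul_assoc]; omega)⟩

theorem two_pow_cardFactors_le {n : ℕ} (hn : n ≠ 0) : 2 ^ cardFactors n ≤ n := by
  rw [cardFactors_apply]
  conv_rhs => rw [← Nat.prod_primeFactorsList hn]
  exact List.pow_card_le_prod _ _ fun p hp => (Nat.prime_of_mem_primeFactorsList hp).two_le

/-- A Chebyshev-type form of the upper bound in Mertens' second theorem. -/
theorem sum_inv_prime_le (G : ℕ) (hG : 1 ≤ G) :
    ∑ p ∈ (Finset.Icc 1 (2 ^ G)).filter Nat.Prime, (1 : ℝ) / p ≤ 5 + 4 * Real.log G := by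
  have key : ∑ p ∈ (Finset.Icc 1 (2 ^ G)).filter Nat.Prime, (1 : ℝ) / p ≤ 1 + 4 * harmonic (G - 1) := by
    induction G, hG using Nat.le_induction with
    | base =>
      have : (Finset.Icc 1 (2 ^ 1)).filter Nat.Prime = {2} := by decide
      rw [this]
      norm_num [harmonic]
    | succ j hj ih =>
      have hsplit : (Finset.Icc 1 (2 ^ (j + 1))).filter Nat.Prime =
          (Finset.Icc 1 (2 ^ j)).filter Nat.Prime ∪
            (Finset.Ioc (2 ^ j) (2 ^ (j + 1))).filter Nat.Prime := by
        ext p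
        have : 2 ^ (j + 1) = 2 * 2 ^ j := pow_succ' _ _
        have : 1 ≤ 2 ^ j := Nat.one_le_two_pow
        simp only [Finset.mem_union, Finset.mem_filter, Finset.mem_Icc, Finset.mem_Ioc]
        constructor
        · rintro ⟨⟨h1, h2⟩, h3⟩
          by_cases h : p ≤ 2 ^ j
          · exact Or.inl ⟨⟨h1, h⟩, h3⟩
          · exact Or.inr ⟨⟨by omega, h2⟩, h3⟩
        · rintro (⟨⟨h1, h2⟩, h3⟩ | ⟨⟨h1, h2⟩, h3⟩)
          · exact ⟨⟨h1, by omega⟩, h3⟩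
          · exact ⟨⟨by omega, h2⟩, h3⟩
      have hdisj : Disjoint ((Finset.Icc 1 (2 ^ j)).filter Nat.Prime)
          ((Finset.Ioc (2 ^ j) (2 ^ (j + 1))).filter Nat.Prime) := by
        rw [Finset.disjoint_left]
        intro p hp hp'
        simp only [Finset.mem_filter, Finset.mem_Icc, Finset.mem_Ioc] at hp hp'
        omega
      have hj0 : (0 : ℝ) < j := by exact_mod_cast hj
      have hl2 : 0 < Real.log 2 := Real.log_pos (by norm_num)
      have hdyadic : ∑ p ∈ (Finset.Ioc (2 ^ j) (2 ^ (j + 1))).filter Nat.Prime, (1 : ℝ) / p ≤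
          4 / j := by
        have htheta : ∑ p ∈ (Finset.Ioc (2 ^ j) (2 ^ (j + 1))).filter Nat.Prime, Real.log p ≤
            Real.log 4 * 2 ^ (j + 1) := by
          refine le_trans ?_ (Chebyshev.theta_le_log4_mul_x (x := 2 ^ (j + 1)) (by positivity))
          rw [Chebyshev.theta]
          apply Finset.sum_le_sum_of_subset_of_nonneg
          · have : ⌊(2 : ℝ) ^ (j + 1)⌋₊ = 2 ^ (j + 1) := by
              exact_mod_cast Nat.floor_natCast (R := ℝ) (2 ^ (j + 1))
            rw [this]
            intro p hp
            simp only [Finset.mem_filter, Finset.mem_Ioc] at hp ⊢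
            exact ⟨⟨hp.2.pos, hp.1.2⟩, hp.2⟩
          · intro p _ _
            exact Real.log_natCast_nonneg p
        have hterm : ∀ p ∈ (Finset.Ioc (2 ^ j) (2 ^ (j + 1))).filter Nat.Prime,
            (1 : ℝ) / p ≤ Real.log p * (1 / (2 ^ j * (j * Real.log 2))) := by
          intro p hp
          simp only [Finset.mem_filter, Finset.mem_Ioc] at hp
          have hp1 : (2 : ℝ) ^ j ≤ p := by exact_mod_cast hp.1.1.le
          have hlog : j * Real.log 2 ≤ Real.log p := by
            rw [← Real.log_pow]
            exact Real.log_le_log (by positivity) hp1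
          have h2j : (0 : ℝ) < 2 ^ j := by positivity
          rw [mul_one_div, div_le_div_iff₀ (by linarith) (by positivity), one_mul]
          rw [mul_comm (Real.log p)]
          exact mul_le_mul hp1 hlog (by positivity) (by linarith)
        calc _ ≤ _ := Finset.sum_le_sum hterm
          _ ≤ (Real.log 4 * 2 ^ (j + 1)) * (1 / (2 ^ j * (j * Real.log 2))) := by
              rw [← Finset.sum_mul]
              gcongr
          _ = 4 / j := by
              have : Real.log 4 = 2 * Real.log 2 := by
                rw [show (4 : ℝ) = 2 ^ 2 by norm_num, Real.log_pow]; norm_num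
              rw [this]
              field_simp
              ring
      obtain ⟨i, rfl⟩ : ∃ i, j = i + 1 := ⟨j - 1, by omega⟩
      rw [hsplit, Finset.sum_union hdisj]
      simp only [Nat.add_sub_cancel] at ih ⊢
      rw [harmonic_succ]
      push_cast at hdyadic ih ⊢
      rw [div_eq_mul_inv] at hdyadic
      linarith
  have h1 := harmonic_le_one_add_log (G - 1)
  have h2 : Real.log (G - 1 : ℕ) ≤ Real.log G := by
    rcases Nat.eq_zero_or_pos (G - 1) with h | h
    · rw [h]
      simpa using Real.log_natCast_nonneg G
    · exact Real.log_le_log (by exact_mod_cast h) (by exact_mod_cast Nat.sub_le G 1)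
  linarith


theorem abs_card_filter_dvd_sub_le {m c : ℕ} (d Y : ℕ) (hm : 0 < m) (h : m.Coprime c) :
    |(((Finset.range Y).filter fun y => m ∣ c * y + d).card : ℝ) - Y / m| ≤ 1 := by
  obtain ⟨v, hv⟩ : ∃ v, m ∣ c * v + d := by
    obtain ⟨x, hx⟩ := Nat.exists_mul_mod_eq_of_coprime (m * d - d) h.symm hm.ne'
    refine ⟨x, ?_⟩
    have h1 : c * x + d ≡ (m * d - d) + d [MOD m] := Nat.ModEq.add_right d hx.2
    rw [Nat.sub_add_cancel (Nat.le_mul_of_pos_left d hm)] at h1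
    exact (Nat.modEq_zero_iff_dvd).1 (h1.trans ((Nat.modEq_zero_iff_dvd).2 (dvd_mul_right m d)))
  have hiff : ∀ y, m ∣ c * y + d ↔ y ≡ v [MOD m] := by
    intro y
    constructor
    · intro hy
      have h2 : c * y + d ≡ c * v + d [MOD m] :=
        ((Nat.modEq_zero_iff_dvd).2 hy).trans ((Nat.modEq_zero_iff_dvd).2 hv).symm
      exact Nat.ModEq.cancel_left_of_coprime h (Nat.ModEq.add_right_cancel' d h2)
    · intro hy
      exact (Nat.modEq_zero_iff_dvd).1
        (((hy.mul_left c).add_right d).trans ((Nat.modEq_zero_iff_dvd).2 hv))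
  have hcard : ((Finset.range Y).filter fun y => m ∣ c * y + d).card =
      Y / m + if v % m < Y % m then 1 else 0 := by
    rw [← Nat.count_modEq_card Y hm v, Nat.count_eq_card_filter_range]
    simp only [hiff]
  have h1 : ((Y / m : ℕ) : ℝ) ≤ Y / m := Nat.cast_div_le
  have h2 : (Y : ℝ) / m < (Y / m : ℕ) + 1 := by
    rw [div_lt_iff₀ (by exact_mod_cast hm)]
    exact_mod_cast Nat.lt_mul_of_div_lt (Nat.lt_succ_self _) hm |>.trans_eq (by simp)
  rw [hcard, abs_le]
  split_ifs <;> push_cast <;> constructor <;> linarith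

theorem card_filter_dvd_le {m c : ℕ} (d Y : ℕ) (hm : 0 < m) (h : m.Coprime c) :
    (((Finset.range Y).filter fun y => m ∣ c * y + d).card : ℝ) ≤ Y / m + 1 := by
  have := (abs_le.1 (abs_card_filter_dvd_sub_le d Y hm h)).2
  linarith

/-- The Turán variance inequality for prime divisors of `c * y + d`. -/
theorem sum_sq_card_filter_dvd_sub_le {T : Finset ℕ} {z c d : ℕ}
    (hT : ∀ p ∈ T, p.Prime ∧ p ≤ z ∧ p.Coprime c) :
    ∑ y ∈ Finset.range (z ^ 2),
      (((T.filter fun p => p ∣ c * y + d).card : ℝ) - ∑ p ∈ T, (1 : ℝ) / p) ^ 2 ≤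
      (z : ℝ) ^ 2 * (∑ p ∈ T, (1 : ℝ) / p + 3) := by
  set S := ∑ p ∈ T, (1 : ℝ) / p with hS
  set Y := z ^ 2 with hY
  let N : ℕ → ℝ := fun m => (((Finset.range Y).filter fun y => m ∣ c * y + d).card : ℝ)
  have hS0 : 0 ≤ S := Finset.sum_nonneg fun p _ => by positivity
  have hTz : (T.card : ℝ) ≤ z := by
    have : T ⊆ Finset.Icc 1 z := fun p hp => by
      obtain ⟨h1, h2, -⟩ := hT p hp
      exact Finset.mem_Icc.2 ⟨h1.pos, h2⟩
    exact_mod_cast (Finset.card_le_card this).trans (by simp)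
  have hSz : S ≤ z := by
    refine le_trans (Finset.sum_le_card_nsmul T _ 1 fun p hp => ?_) (by simpa using hTz)
    have : (1 : ℝ) ≤ p := by exact_mod_cast (hT p hp).1.pos
    rw [div_le_one (by linarith)]
    exact this
  have hcard : ∀ y, ((T.filter fun p => p ∣ c * y + d).card : ℝ) =
      ∑ p ∈ T, if p ∣ c * y + d then (1 : ℝ) else 0 := fun y => by simp
  have hN : ∀ m, N m = ∑ y ∈ Finset.range Y, if m ∣ c * y + d then (1 : ℝ) else 0 :=
    fun m => by simp [N]
  have hfirst : Y * S - z ≤ ∑ y ∈ Finset.range Y, ((T.filter fun p => p ∣ c * y + d).card : ℝ) := by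
    simp only [hcard]
    rw [Finset.sum_comm]
    simp only [← hN]
    have : ∑ p ∈ T, ((Y : ℝ) * (1 / p) - 1) ≤ ∑ p ∈ T, N p := by
      refine Finset.sum_le_sum fun p hp => ?_
      obtain ⟨h1, -, h3⟩ := hT p hp
      have := (abs_le.1 (abs_card_filter_dvd_sub_le d Y h1.pos h3)).1
      rw [mul_one_div]
      simp only [N]
      linarith
    rw [Finset.sum_sub_distrib, ← Finset.mul_sum, ← hS] at this
    simp only [Finset.sum_const, nsmul_eq_mul, mul_one] at this
    linarith
  have hsecond : ∑ y ∈ Finset.range Y, ((T.filter fun p => p ∣ c * y + d).card : ℝ) ^ 2 ≤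
      Y * S ^ 2 + Y * S + z ^ 2 := by
    have hexp : ∑ y ∈ Finset.range Y, ((T.filter fun p => p ∣ c * y + d).card : ℝ) ^ 2 =
        ∑ p ∈ T, ∑ q ∈ T, ∑ y ∈ Finset.range Y,
          if p ∣ c * y + d ∧ q ∣ c * y + d then (1 : ℝ) else 0 := by
      simp only [hcard, sq, Finset.sum_mul_sum]
      rw [Finset.sum_comm]
      refine Finset.sum_congr rfl fun p _ => ?_
      rw [Finset.sum_comm]
      refine Finset.sum_congr rfl fun q _ => Finset.sum_congr rfl fun y _ => ?_
      by_cases h1 : p ∣ c * y + d <;> by_cases h2 : q ∣ c * y + d <;> simp [h1, h2]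
    rw [hexp]
    have hpair : ∀ p ∈ T, ∀ q ∈ T, (∑ y ∈ Finset.range Y,
        if p ∣ c * y + d ∧ q ∣ c * y + d then (1 : ℝ) else 0) ≤
        (Y * ((1 / p) * (1 / q)) + 1) + if p = q then (Y * (1 / p) : ℝ) else 0 := by
      intro p hp q hq
      obtain ⟨hp1, -, hp3⟩ := hT p hp
      obtain ⟨hq1, -, hq3⟩ := hT q hq
      split_ifs with hpq
      · subst hpq
        simp only [and_self]
        rw [← hN]
        have := card_filter_dvd_le d Y hp1.pos hp3
        have h0 : (0 : ℝ) ≤ Y * ((1 / p) * (1 / p)) := by positivity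
        rw [mul_one_div (Y : ℝ) (p : ℝ)]
        simp only [N]
        linarith
      · have hcop : p.Coprime q := (Nat.coprime_primes hp1 hq1).2 hpq
        have hiff : ∀ y, (p ∣ c * y + d ∧ q ∣ c * y + d) ↔ p * q ∣ c * y + d := fun y =>
          ⟨fun h => hcop.mul_dvd_of_dvd_of_dvd h.1 h.2,
            fun h => ⟨dvd_of_mul_right_dvd h, dvd_of_mul_left_dvd h⟩⟩
        simp only [hiff]
        rw [← hN]
        have := card_filter_dvd_le d Y (Nat.mul_pos hp1.pos hq1.pos) (hp3.mul_left hq3)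
        rw [add_zero, one_div_mul_one_div, mul_one_div]
        simp only [N]
        push_cast at this
        exact this
    calc _ ≤ ∑ p ∈ T, ∑ q ∈ T, ((Y * ((1 / p) * (1 / q)) + 1) +
          if p = q then (Y * (1 / p) : ℝ) else 0) :=
          Finset.sum_le_sum fun p hp => Finset.sum_le_sum fun q hq => hpair p hp q hq
      _ = Y * S ^ 2 + T.card * T.card + Y * S := by
          simp only [Finset.sum_add_distrib, Finset.sum_ite_eq, sq, hS]
          rw [Finset.sum_mul_sum, Finset.mul_sum, Finset.mul_sum]
          simp only [Finset.mul_sum, Finset.sum_const, nsmul_eq_mul, mul_one]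
          congr 1
          exact Finset.sum_congr rfl fun p hp => by simp [hp]
      _ ≤ _ := by nlinarith [Nat.cast_nonneg (α := ℝ) T.card]
  have hYz : (Y : ℝ) = (z : ℝ) ^ 2 := by simp [hY]
  have hexpand : ∑ y ∈ Finset.range Y, (((T.filter fun p => p ∣ c * y + d).card : ℝ) - S) ^ 2 =
      ∑ y ∈ Finset.range Y, ((T.filter fun p => p ∣ c * y + d).card : ℝ) ^ 2 -
        2 * S * ∑ y ∈ Finset.range Y, ((T.filter fun p => p ∣ c * y + d).card : ℝ) +
        Y * S ^ 2 := by
    simp only [sub_sq, Finset.sum_add_distrib, Finset.sum_sub_distrib, Finset.mul_sum]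
    simp only [Finset.sum_const, Finset.card_range, nsmul_eq_mul]
    congr 2
    exact Finset.sum_congr rfl fun y _ => by ring
  rw [hexpand]
  rw [hYz] at hfirst hsecond ⊢
  nlinarith [mul_le_mul_of_nonneg_left hfirst hS0, mul_le_mul_of_nonneg_right hSz hS0,
    mul_le_mul_of_nonneg_right hSz (Nat.cast_nonneg (α := ℝ) z)]

theorem cardFactors_le_card_add {z m : ℕ} {T : Finset ℕ} (hm : 0 < m) (hmz : m < z ^ 4)
    (hT : ∀ p ∈ T, p.Prime) (hmem : ∀ p, p.Prime → p ∣ m → p ≤ z → p ∈ T) :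
    cardFactors m ≤ (T.filter fun p => p ∣ m).card +
      ∑ p ∈ T, ∑ j ∈ Finset.Icc 2 (4 * z), (if p ^ j ∣ m then 1 else 0) + 3 := by
  have hlog : ∀ p, p.Prime → m < p ^ (4 * z + 1) := fun p hp => calc
    m < z ^ 4 := hmz
    _ ≤ (2 ^ z) ^ 4 := Nat.pow_le_pow_left Nat.lt_two_pow_self.le 4
    _ = 2 ^ (4 * z) := by rw [← pow_mul, mul_comm]
    _ ≤ p ^ (4 * z) := Nat.pow_le_pow_left hp.two_le _
    _ ≤ p ^ (4 * z + 1) := Nat.pow_le_pow_right hp.pos (Nat.le_succ _)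
  have hfact : ∀ p ∈ T, m.factorization p ≤ (if p ∣ m then 1 else 0) +
      ∑ j ∈ Finset.Icc 2 (4 * z), (if p ^ j ∣ m then 1 else 0) := by
    intro p hp
    have hpp := hT p hp
    by_cases hpm : p ∣ m
    · have hsub : Finset.Icc 2 (m.factorization p) ⊆
          (Finset.Icc 2 (4 * z)).filter fun j => p ^ j ∣ m := by
        intro j hj
        rw [Finset.mem_Icc] at hj
        have hdvd : p ^ j ∣ m := (hpp.pow_dvd_iff_le_factorization hm.ne').2 hj.2
        refine Finset.mem_filter.2 ⟨Finset.mem_Icc.2 ⟨hj.1, ?_⟩, hdvd⟩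
        have := (Nat.le_of_dvd hm hdvd).trans_lt (hlog p hpp)
        exact Nat.lt_succ_iff.1 ((Nat.pow_lt_pow_iff_right hpp.one_lt).1 this)
      have := Finset.card_le_card hsub
      rw [Nat.card_Icc] at this
      rw [if_pos hpm, ← Finset.card_filter]
      omega
    · rw [Nat.factorization_eq_zero_of_not_dvd hpm]
      exact Nat.zero_le _
  have hbig : ∑ p ∈ m.primeFactors \ T, m.factorization p ≤ 3 := by
    have h1 : z ^ (∑ p ∈ m.primeFactors \ T, m.factorization p) ≤ m := calc
      _ = ∏ p ∈ m.primeFactors \ T, z ^ m.factorization p := by rw [Finset.prod_pow_eq_pow_sum]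
      _ ≤ ∏ p ∈ m.primeFactors \ T, p ^ m.factorization p := by
          refine Finset.prod_le_prod' fun p hp => Nat.pow_le_pow_left ?_ _
          rw [Finset.mem_sdiff, Nat.mem_primeFactors] at hp
          by_contra! h
          exact hp.2 (hmem p hp.1.1 hp.1.2.1 h.le)
      _ ≤ ∏ p ∈ m.primeFactors, p ^ m.factorization p := by
          refine Finset.prod_le_prod_of_subset_of_one_le' Finset.sdiff_subset fun p hp _ => ?_
          exact Nat.one_le_pow _ _ (Nat.prime_of_mem_primeFactors hp).pos
      _ = m := Nat.prod_factorization_pow_eq_self hm.ne'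
    have hz : 1 ≤ z := by
      by_contra! h
      obtain rfl : z = 0 := by omega
      simp at hmz
    by_contra! h
    exact absurd ((Nat.pow_le_pow_right hz h).trans h1) (by simpa using hmz)
  have hsum : cardFactors m ≤ ∑ p ∈ T, m.factorization p +
      ∑ p ∈ m.primeFactors \ T, m.factorization p := by
    rw [cardFactors_eq_sum_factorization, Finsupp.sum, Nat.support_factorization,
      ← Finset.sum_union Finset.disjoint_sdiff]
    exact Finset.sum_le_sum_of_subset (by simp)
  have h2 := Finset.sum_le_sum hfact
  rw [Finset.sum_add_distrib, ← Finset.card_filter] at h2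
  omega

theorem card_filter_le_cardFactors {m : ℕ} {T : Finset ℕ} (hm : m ≠ 0)
    (hT : ∀ p ∈ T, p.Prime) : (T.filter fun p => p ∣ m).card ≤ cardFactors m := by
  rw [cardFactors_apply]
  refine le_trans (Finset.card_le_card fun p hp => ?_) (List.toFinset_card_le _)
  rw [Finset.mem_filter] at hp
  rw [List.mem_toFinset, Nat.mem_primeFactorsList hm]
  exact ⟨hT p hp.1, hp.2⟩

theorem sum_higher_powers_le {T : Finset ℕ} {z c d : ℕ} (hz : 1 ≤ z)
    (hT : ∀ p ∈ T, p.Prime ∧ p ≤ z ∧ p.Coprime c) :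
    ∑ y ∈ Finset.range (z ^ 2), ∑ p ∈ T, ∑ j ∈ Finset.Icc 2 (4 * z),
      (if p ^ j ∣ c * y + d then (1 : ℝ) else 0) ≤ (z : ℝ) ^ 2 * 6 := by
  have hsub : T ⊆ Finset.Icc 2 z := fun p hp => by
    obtain ⟨h1, h2, -⟩ := hT p hp
    exact Finset.mem_Icc.2 ⟨h1.two_le, h2⟩
  have hTz : (T.card : ℝ) ≤ z := by
    exact_mod_cast (Finset.card_le_card hsub).trans (by simp)
  have hgeom : ∀ p : ℕ, 2 ≤ p → ∀ J : ℕ,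
      ∑ j ∈ Finset.Icc 2 J, (1 : ℝ) / (p : ℝ) ^ j ≤ 1 / (p - 1) - 1 / p := by
    intro p hp J
    have hp' : (2 : ℝ) ≤ p := by exact_mod_cast hp
    have hstrong : ∀ J : ℕ, ∑ j ∈ Finset.Icc 2 (J + 1), (1 : ℝ) / (p : ℝ) ^ j =
        1 / (p - 1) - 1 / p - 1 / ((p - 1) * (p : ℝ) ^ (J + 1)) := by
      intro J
      induction J with
      | zero =>
        have : (p : ℝ) - 1 ≠ 0 := by linarith
        simp
        field_simp
        ring
      | succ J ih =>
        have : (p : ℝ) - 1 ≠ 0 := by linarith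
        rw [Finset.sum_Icc_succ_top (by omega), ih]
        field_simp
        ring
    have hp1 : (0 : ℝ) < p - 1 := by linarith
    rcases J with _ | J
    · simp only [Finset.Icc_eq_empty_of_lt (show 0 < 2 by norm_num), Finset.sum_empty]
      rw [sub_nonneg]
      exact one_div_le_one_div_of_le hp1 (by linarith)
    · rw [hstrong]
      have : 0 ≤ 1 / (((p : ℝ) - 1) * (p : ℝ) ^ (J + 1)) := by positivity
      linarith
  have htele : ∀ z : ℕ, 1 ≤ z →
      ∑ p ∈ Finset.Icc 2 z, ((1 : ℝ) / (p - 1) - 1 / p) = 1 - 1 / z := by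
    intro z hz
    induction z, hz using Nat.le_induction with
    | base => simp
    | succ n hn ih =>
      rw [Finset.sum_Icc_succ_top (by omega), ih]
      push_cast
      ring
  have hsum : ∑ p ∈ T, ∑ j ∈ Finset.Icc 2 (4 * z), (1 : ℝ) / (p : ℝ) ^ j ≤ 1 := calc
    _ ≤ ∑ p ∈ T, ((1 : ℝ) / (p - 1) - 1 / p) :=
        Finset.sum_le_sum fun p hp => hgeom p (hT p hp).1.two_le _
    _ ≤ ∑ p ∈ Finset.Icc 2 z, ((1 : ℝ) / (p - 1) - 1 / p) := by
        refine Finset.sum_le_sum_of_subset_of_nonneg hsub fun p hp _ => ?_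
        have : (2 : ℝ) ≤ p := by exact_mod_cast (Finset.mem_Icc.1 hp).1
        rw [sub_nonneg]
        exact one_div_le_one_div_of_le (by linarith) (by linarith)
    _ ≤ 1 := by
        rw [htele z hz]
        have : (0 : ℝ) ≤ 1 / z := by positivity
        linarith
  calc _ = ∑ p ∈ T, ∑ j ∈ Finset.Icc 2 (4 * z), (((Finset.range (z ^ 2)).filter
          fun y => p ^ j ∣ c * y + d).card : ℝ) := by
        rw [Finset.sum_comm]
        refine Finset.sum_congr rfl fun p _ => ?_
        rw [Finset.sum_comm]
        exact Finset.sum_congr rfl fun j _ => by simp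
    _ ≤ ∑ p ∈ T, ∑ j ∈ Finset.Icc 2 (4 * z), ((z : ℝ) ^ 2 * (1 / (p : ℝ) ^ j) + 1) := by
        refine Finset.sum_le_sum fun p hp => Finset.sum_le_sum fun j _ => ?_
        obtain ⟨h1, -, h3⟩ := hT p hp
        have := card_filter_dvd_le d (z ^ 2) (pow_pos h1.pos j) (h3.pow_left j)
        push_cast at this
        rwa [mul_one_div]
    _ ≤ (z : ℝ) ^ 2 * 1 + T.card * (4 * z) := by
        simp only [Finset.sum_add_distrib, ← Finset.mul_sum]
        gcongr
        simp only [Finset.sum_const, Nat.card_Icc, nsmul_eq_mul, mul_one]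
        gcongr
        exact_mod_cast (by omega : 4 * z + 1 - 2 ≤ 4 * z)
    _ ≤ _ := by nlinarith

/-- The mean deviation of `Ω (c * y + d)` from a sum of reciprocals of primes. -/
theorem sum_abs_cardFactors_sub_le {T : Finset ℕ} {z c d : ℕ} (hz : 1 ≤ z)
    (hd : 0 < d) (hlt : ∀ y < z ^ 2, c * y + d < z ^ 4)
    (hT : ∀ p ∈ T, p.Prime ∧ p ≤ z ∧ p.Coprime c)
    (hmem : ∀ p, p.Prime → (∃ y, p ∣ c * y + d) → p ≤ z → p ∈ T) :
    ∑ y ∈ Finset.range (z ^ 2),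
      |(cardFactors (c * y + d) : ℝ) - ∑ p ∈ T, (1 : ℝ) / p| ≤
      (z : ℝ) ^ 2 * (√(∑ p ∈ T, (1 : ℝ) / p + 3) + 9) := by
  set S := ∑ p ∈ T, (1 : ℝ) / p with hS
  have hS0 : 0 ≤ S := Finset.sum_nonneg fun p _ => by positivity
  set w := √(S + 3) with hw
  have hw0 : 0 < w := Real.sqrt_pos.2 (by linarith)
  have hww : w ^ 2 = S + 3 := Real.sq_sqrt (by linarith)
  have hpoint : ∀ y ∈ Finset.range (z ^ 2), |(cardFactors (c * y + d) : ℝ) - S| ≤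
      ((((T.filter fun p => p ∣ c * y + d).card : ℝ) - S) ^ 2 * (1 / (2 * w)) + w / 2) +
      (∑ p ∈ T, ∑ j ∈ Finset.Icc 2 (4 * z), (if p ^ j ∣ c * y + d then (1 : ℝ) else 0)) + 3 := by
    intro y hy
    have hm : 0 < c * y + d := by omega
    have h1 : (cardFactors (c * y + d) : ℝ) ≤ _ := Nat.cast_le.2
      (cardFactors_le_card_add hm (hlt y (Finset.mem_range.1 hy)) (fun p hp => (hT p hp).1)
        (fun p hp hdvd => hmem p hp ⟨y, hdvd⟩))
    have h2 : (_ : ℝ) ≤ cardFactors (c * y + d) := Nat.cast_le.2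
      (card_filter_le_cardFactors hm.ne' fun p hp => (hT p hp).1)
    push_cast at h1
    set f : ℝ := ((T.filter fun p => p ∣ c * y + d).card : ℝ)
    have h3 : |f - S| ≤ (f - S) ^ 2 * (1 / (2 * w)) + w / 2 := by
      rw [← sq_abs, ← sub_nonneg]
      have : |f - S| ^ 2 * (1 / (2 * w)) + w / 2 - |f - S| = (|f - S| - w) ^ 2 / (2 * w) := by
        field_simp
        ring
      rw [this]
      positivity
    have h4 := abs_le.1 h3
    rw [abs_le]
    constructor <;> linarith
  refine (Finset.sum_le_sum hpoint).trans ?_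
  simp only [Finset.sum_add_distrib, ← Finset.sum_mul]
  have h1 := sum_sq_card_filter_dvd_sub_le (d := d) hT
  have h2 := sum_higher_powers_le (d := d) hz hT
  rw [← hS, ← hww] at h1
  have h3 := mul_le_mul_of_nonneg_right h1 (show 0 ≤ 1 / (2 * w) by positivity)
  have h4 : (z : ℝ) ^ 2 * w ^ 2 * (1 / (2 * w)) = z ^ 2 * (w / 2) := by
    field_simp
  rw [h4] at h3
  simp only [Finset.sum_const, Finset.card_range, nsmul_eq_mul]
  push_cast
  linarith

/-- Linear forms in `y` whose differences divide them and whose fixed divisors all have the same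
number of prime factors. -/
theorem exists_linear_forms (k : ℕ) (hk : 1 ≤ k) :
    ∃ (L M x : ℕ) (s : Finset ℕ), s.card = k ∧ 0 < L ∧
      L ≤ 2 ^ (5 * (2 ^ k * k.factorial) ^ 3) ∧
      (∀ a ∈ s, ∃ c d, c ≤ L ∧ 0 < d ∧ d ≤ 2 * c + 1 ∧ c.Coprime d ∧
        (∀ p, p.Prime → (p ∣ c ↔ p ∣ L)) ∧
        ∀ y, cardFactors (x + L * y + a) = M + cardFactors (c * y + d)) ∧
      ∀ a ∈ s, ∀ b ∈ s, a < b → ∀ y,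
        b - a ∣ x + L * y + a ∧ k * (b - a) ≤ x + L * y + a := by
  obtain ⟨s, hcard, h2, hdvd, hprod⟩ := exists_finset_sub_dvd k hk
  set P := ∏ a ∈ s, a with hP
  set E := 2 ^ k * k.factorial with hE
  have hE1 : 2 ≤ E := calc
    2 = 2 ^ 1 * 1 := by norm_num
    _ ≤ 2 ^ k * k.factorial :=
      Nat.mul_le_mul (Nat.pow_le_pow_right (by norm_num) hk) (Nat.factorial_pos k)
  have hkE : k ≤ E := Nat.lt_two_pow_self.le.trans (Nat.le_mul_of_pos_right _ (Nat.factorial_pos k))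
  have hdP : ∀ a ∈ s, a ∣ P := fun a ha => Finset.dvd_prod_of_mem _ ha
  have hPpos : 0 < P := Finset.prod_pos fun a ha => by have := h2 a ha; omega
  have hleP : ∀ a ∈ s, a ≤ P := fun a ha => Nat.le_of_dvd hPpos (hdP a ha)
  have hkP : k ≤ P := calc
    k ≤ 2 ^ k := Nat.lt_two_pow_self.le
    _ = ∏ _a ∈ s, 2 := by rw [Finset.prod_const, hcard]
    _ ≤ P := Finset.prod_le_prod' h2
  obtain ⟨q, hinj, hq⟩ := exists_injOn_primes s P hPpos
  have hΩ : ∀ a ∈ s, cardFactors a ≤ E := fun a ha => by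
    have h := two_pow_cardFactors_le (n := a) (by have := h2 a ha; omega)
    exact (Nat.pow_le_pow_iff_right (by norm_num)).1 (h.trans ((hleP a ha).trans hprod))
  let e : ℕ → ℕ := fun a => E + 1 - cardFactors a
  have he : ∀ a ∈ s, 1 ≤ e a := fun a ha => by have := hΩ a ha; simp only [e]; omega
  set R := ∏ a ∈ s, q a ^ (e a + 1) with hR
  have hRpos : 0 < R := Finset.prod_pos fun a ha => pow_pos (hq a ha).1.pos _
  set L := P ^ 2 * R with hL
  have hLpos : 0 < L := by positivity
  have hcopqP : ∀ a ∈ s, (q a).Coprime P := fun a ha =>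
    ((hq a ha).1.coprime_iff_not_dvd).2 (Nat.not_dvd_of_pos_of_lt hPpos (hq a ha).2.1)
  obtain ⟨x₀, hx₀P, hx₀q⟩ : ∃ x₀, x₀ ≡ 0 [MOD P ^ 2] ∧
      ∀ a ∈ s, x₀ ≡ q a ^ e a + (q a ^ (e a + 1) * a - a) [MOD q a ^ (e a + 1)] := by
    obtain ⟨u, hu⟩ := Nat.chineseRemainderOfFinset
      (fun a => q a ^ e a + (q a ^ (e a + 1) * a - a)) (fun a => q a ^ (e a + 1)) s
      (fun a ha => pow_ne_zero _ (hq a ha).1.ne_zero) (by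
        intro a ha b hb hab
        exact Nat.Coprime.pow _ _ (((Nat.coprime_primes (hq a ha).1 (hq b hb).1)).2
          fun h => hab (hinj ha hb h)))
    have hcop : (P ^ 2).Coprime R := Nat.Coprime.prod_right fun a ha =>
      ((hcopqP a ha).symm.pow_left 2).pow_right _
    obtain ⟨v, hv1, hv2⟩ := Nat.chineseRemainder hcop 0 u
    exact ⟨v, hv1, fun a ha => (hv2.of_dvd (Finset.dvd_prod_of_mem _ ha)).trans (hu a ha)⟩
  obtain ⟨x, hxL, hxlt, hLx⟩ : ∃ x, x ≡ x₀ [MOD L] ∧ x < 2 * L ∧ L ≤ x := by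
    refine ⟨x₀ % L + L, ?_, ?_, Nat.le_add_left _ _⟩
    · rw [Nat.ModEq, Nat.add_mod_right, Nat.mod_mod]
    · have := Nat.mod_lt x₀ hLpos
      omega
  have hPx : P ^ 2 ∣ x := (Nat.modEq_zero_iff_dvd).1 ((hxL.of_dvd (dvd_mul_right _ _)).trans hx₀P)
  have hqR : ∀ a ∈ s, q a ^ (e a + 1) ∣ R := fun a ha => Finset.dvd_prod_of_mem _ ha
  have hxq : ∀ a ∈ s, x + a ≡ q a ^ e a [MOD q a ^ (e a + 1)] := by
    intro a ha
    have h1 := ((hxL.of_dvd ((hqR a ha).trans (dvd_mul_left _ _))).trans (hx₀q a ha)).add_right a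
    rw [add_assoc (q a ^ e a),
      Nat.sub_add_cancel (Nat.le_mul_of_pos_left a (pow_pos (hq a ha).1.pos _))] at h1
    refine h1.trans ?_
    rw [Nat.ModEq, Nat.add_mul_mod_self_left]
  have hqx : ∀ a ∈ s, q a ^ e a ∣ x + a := fun a ha =>
    ((hxq a ha).dvd_iff (pow_dvd_pow _ (Nat.le_succ _))).2 dvd_rfl
  have hqx' : ∀ a ∈ s, ¬ q a ^ (e a + 1) ∣ x + a := fun a ha h => by
    have := ((hxq a ha).dvd_iff dvd_rfl).1 h
    have := (Nat.pow_dvd_pow_iff_le_right (hq a ha).1.one_lt).1 this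
    omega
  have hax : ∀ a ∈ s, a ∣ x := fun a ha => (hdP a ha).trans ((dvd_pow_self P two_ne_zero).trans hPx)
  refine ⟨L, E + 1, x, s, hcard, hLpos, ?_, ?_, ?_⟩
  · have hqle : ∀ a ∈ s, q a ^ (e a + 1) ≤ (2 ^ (k + E)) ^ (E + 2) := by
      intro a ha
      have h1 : q a ≤ 2 ^ (k + E) := by
        refine (hq a ha).2.2.trans ?_
        rw [hcard, pow_add]
        exact Nat.mul_le_mul_left _ hprod
      refine (Nat.pow_le_pow_left h1 _).trans (Nat.pow_le_pow_right (by positivity) ?_)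
      simp only [e]
      omega
    calc L ≤ (2 ^ E) ^ 2 * ((2 ^ (k + E)) ^ (E + 2)) ^ k := by
          refine Nat.mul_le_mul (Nat.pow_le_pow_left hprod 2) ?_
          refine (Finset.prod_le_prod' hqle).trans ?_
          rw [Finset.prod_const, hcard]
      _ = 2 ^ (E * 2 + (k + E) * (E + 2) * k) := by
          rw [← pow_mul, ← pow_mul, ← pow_mul, ← pow_add, mul_assoc (k + E)]
      _ ≤ _ := by
          apply Nat.pow_le_pow_right (by norm_num)
          have : (k + E) * (E + 2) * k ≤ (E + E) * (E + E) * E := by gcongr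
          nlinarith
  · intro a ha
    have ha0 : 0 < a := by have := h2 a ha; omega
    obtain ⟨Pa, hPa⟩ := hdP a ha
    obtain ⟨Ra, hRa⟩ := hqR a ha
    set Q := q a ^ e a with hQ
    have hQpos : 0 < Q := pow_pos (hq a ha).1.pos _
    have hcopaQ : a.Coprime Q :=
      (((hcopqP a ha).coprime_dvd_right (hdP a ha)).pow_left _).symm
    obtain ⟨d, hd⟩ : a * Q ∣ x + a :=
      hcopaQ.mul_dvd_of_dvd_of_dvd ((hax a ha).add dvd_rfl) (hqx a ha)
    set c := P * Pa * (q a * Ra) with hc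
    have hLc : L = a * Q * c := by
      rw [hL, hRa, hc, pow_succ (q a), sq P]
      nth_rewrite 1 [hPa]
      ring
    have hApos : 0 < a * Q := by positivity
    have hdpos : 0 < d := Nat.pos_of_ne_zero fun h => by
      rw [h, mul_zero] at hd
      omega
    have hcpos : 0 < c := Nat.pos_of_ne_zero fun h => by
      rw [h, mul_zero] at hLc
      omega
    have hprime : ∀ p, p.Prime → (p ∣ c ↔ p ∣ L) := by
      intro p hp
      refine ⟨fun h => hLc ▸ h.mul_left _, fun h => ?_⟩
      rcases (hp.dvd_mul).1 h with h | h
      · exact ((hp.dvd_of_dvd_pow h).mul_right _).mul_right _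
      · rw [hRa, pow_succ, mul_assoc] at h
        rcases (hp.dvd_mul).1 h with h | h
        · exact ((hp.dvd_of_dvd_pow h).mul_right _).mul_left _
        · exact h.mul_left _
    refine ⟨c, d, ?_, hdpos, ?_, ?_, hprime, ?_⟩
    · rw [hLc]
      exact Nat.le_mul_of_pos_left _ hApos
    · have h1 : a ≤ a * Q := Nat.le_mul_of_pos_right _ hQpos
      have h3 : a * Q * d ≤ a * Q * (2 * c + 1) := by nlinarith
      exact Nat.le_of_mul_le_mul_left h3 hApos
    · refine Nat.coprime_of_dvd fun p hp hpc hpd => ?_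
      have hpx : p ∣ x + a := hd ▸ hpd.mul_left _
      rcases (hp.dvd_mul).1 ((hprime p hp).1 hpc) with h | h
      · obtain ⟨w, hw⟩ := hPx
        have hpP := hp.dvd_of_dvd_pow h
        have h3 : Q * d = P * (Pa * w) + 1 := by
          apply Nat.eq_of_mul_eq_mul_left ha0
          have : a * (Q * d) = P * P * w + a := by rw [← mul_assoc, ← hd, hw]; ring
          rw [this]
          nth_rewrite 1 [hPa]
          ring
        have h4 : p ∣ P * (Pa * w) + 1 := h3 ▸ hpd.mul_left _
        exact hp.one_lt.ne' (Nat.dvd_one.1 ((Nat.dvd_add_right (hpP.mul_right _)).1 h4))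
      · obtain ⟨b, hb, hpb⟩ := (hp.prime.dvd_finsetProd_iff _).1 h
        obtain rfl : p = q b := (Nat.prime_dvd_prime_iff_eq hp (hq b hb).1).1
          (hp.dvd_of_dvd_pow hpb)
        by_cases hab : b = a
        · subst hab
          refine hqx' b hb ?_
          rw [hd, pow_succ, mul_assoc]
          exact (mul_dvd_mul_left _ hpd).mul_left _
        · have h5 : q b ∣ x + b := (dvd_pow_self _ (by have := he b hb; omega)).trans (hqx b hb)
          have hlt : q b > P := (hq b hb).2.1
          have hbP := hleP b hb
          have haP := hleP a ha
          rcases lt_or_gt_of_ne hab with h | h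
          · have h6 := Nat.dvd_sub hpx h5
            exact Nat.not_dvd_of_pos_of_lt (by omega) (by omega) h6
          · have h6 := Nat.dvd_sub h5 hpx
            exact Nat.not_dvd_of_pos_of_lt (by omega) (by omega) h6
    · intro y
      have h7 : x + L * y + a = a * Q * (c * y + d) := by
        rw [add_right_comm, hd, hLc]
        ring
      rw [h7, cardFactors_mul hApos.ne' (by omega), cardFactors_mul ha0.ne' hQpos.ne', hQ,
        cardFactors_apply_prime_pow (hq a ha).1]
      have := hΩ a ha
      simp only [e]
      omega
  · intro a ha b hb hab y
    have hba := hdvd a ha b hb hab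
    refine ⟨?_, ?_⟩
    · have h1 : b - a ∣ L := (hba.trans (hdP a ha)).trans
        ((dvd_pow_self P two_ne_zero).trans (dvd_mul_right _ _))
      exact ((hba.trans (hax a ha)).add (h1.mul_right y)).add hba
    · have h1 : b - a ≤ P := (Nat.sub_le _ _).trans (hleP b hb)
      calc k * (b - a) ≤ P * P := Nat.mul_le_mul hkP h1
        _ ≤ P ^ 2 * R := by rw [← sq]; exact Nat.le_mul_of_pos_right _ hRpos
        _ ≤ x + L * y + a := by omega

theorem card_le_of_sum_abs_sub_le {s : Finset ℕ} {f : ℕ → ℕ} {S W : ℝ} (hW : 0 < W)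
    (hf : Set.InjOn f s) (h : ∑ a ∈ s, |(f a : ℝ) - S| ≤ s.card * W) :
    (s.card : ℝ) ≤ 2 * (4 * W + 1) := by
  set B := s.filter fun a => |(f a : ℝ) - S| ≤ 2 * W with hB
  have hsplit : (B.card : ℝ) + (s \ B).card = s.card := by
    rw [add_comm]
    exact_mod_cast Finset.card_sdiff_add_card_eq_card (Finset.filter_subset _ s)
  have hfar : ((s \ B).card : ℝ) * (2 * W) ≤ s.card * W := by
    refine le_trans ?_ h
    rw [← nsmul_eq_mul]
    refine (Finset.card_nsmul_le_sum (s \ B) (fun a => |(f a : ℝ) - S|) _ fun a ha => ?_).trans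
      (Finset.sum_le_sum_of_subset_of_nonneg Finset.sdiff_subset fun a _ _ => abs_nonneg _)
    rw [hB, Finset.mem_sdiff, Finset.mem_filter, not_and, not_le] at ha
    exact (ha.2 ha.1).le
  have hnear : (B.card : ℝ) ≤ 4 * W + 1 := by
    have h1 : B.card ≤ (Finset.Icc ⌈S - 2 * W⌉ ⌊S + 2 * W⌋).card := by
      refine Finset.card_le_card_of_injOn (fun a => (f a : ℤ)) (fun a ha => ?_) fun a ha b hb hab =>
        hf (Finset.filter_subset _ _ ha) (Finset.filter_subset _ _ hb) (Int.natCast_inj.1 hab)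
      rw [hB, Finset.mem_coe, Finset.mem_filter, abs_le] at ha
      rw [Finset.mem_coe, Finset.mem_Icc, Int.ceil_le, Int.le_floor]
      push_cast
      constructor <;> linarith
    rw [Int.card_Icc] at h1
    have h2 : (B.card : ℝ) ≤ ((⌊S + 2 * W⌋ + 1 - ⌈S - 2 * W⌉).toNat : ℝ) := by exact_mod_cast h1
    refine h2.trans ?_
    have h3 : ((⌊S + 2 * W⌋ + 1 - ⌈S - 2 * W⌉ : ℤ) : ℝ) ≤ 4 * W + 1 := by
      push_cast
      linarith [Int.floor_le (S + 2 * W), Int.le_ceil (S - 2 * W)]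
    rcases le_total 0 (⌊S + 2 * W⌋ + 1 - ⌈S - 2 * W⌉) with h4 | h4
    · rwa [← Int.cast_natCast, Int.toNat_of_nonneg h4]
    · rw [Int.toNat_of_nonpos h4]
      simp only [Nat.cast_zero]
      linarith
  have : ((s \ B).card : ℝ) * 2 ≤ s.card := by
    refine le_of_mul_le_mul_right ?_ hW
    linarith
  linarith

theorem two_mul_sqrt_add_lt {t : ℕ} (ht : 100 ≤ t) {S : ℝ}
    (hS : S ≤ 5 + 4 * Real.log (5 * (2 ^ t ^ 4 * (t ^ 4).factorial) ^ 3 : ℕ)) :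
    2 * (4 * (√(S + 3) + 9) + 1) < ((t ^ 4 : ℕ) : ℝ) := by
  have ht' : (100 : ℝ) ≤ t := by exact_mod_cast ht
  have hlogt : Real.log t ≤ t := (Real.log_le_sub_one_of_pos (by linarith)).trans (by linarith)
  have hfac : Real.log ((t ^ 4).factorial : ℕ) ≤ (t : ℝ) ^ 4 * (4 * t) := by
    calc Real.log ((t ^ 4).factorial : ℕ) ≤ Real.log (((t ^ 4) ^ (t ^ 4) : ℕ) : ℝ) := by
          refine Real.log_le_log (by exact_mod_cast Nat.factorial_pos _) ?_
          exact_mod_cast Nat.factorial_le_pow (t ^ 4)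
      _ = (t : ℝ) ^ 4 * (4 * Real.log t) := by
          push_cast
          rw [Real.log_pow, Real.log_pow]
          push_cast
          ring
      _ ≤ _ := by gcongr
  have hlog2 : Real.log 2 ≤ 1 := (Real.log_le_sub_one_of_pos (by norm_num)).trans (by norm_num)
  have hlog5 : Real.log 5 ≤ 4 := (Real.log_le_sub_one_of_pos (by norm_num)).trans (by norm_num)
  have hlog : Real.log (5 * (2 ^ t ^ 4 * (t ^ 4).factorial) ^ 3 : ℕ) ≤
      4 + 3 * ((t : ℝ) ^ 4 + t ^ 4 * (4 * t)) := by
    have hf0 : ((t ^ 4).factorial : ℝ) ≠ 0 := by exact_mod_cast (Nat.factorial_pos _).ne'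
    push_cast
    rw [Real.log_mul (by norm_num) (by positivity), Real.log_pow,
      Real.log_mul (by positivity) hf0, Real.log_pow]
    push_cast
    nlinarith [pow_nonneg (by linarith : (0 : ℝ) ≤ t) 4]
  have hsqrt : √(S + 3) ≤ 9 * (t : ℝ) ^ 3 := by
    rw [Real.sqrt_le_left (by positivity)]
    have h5 : (t : ℝ) ^ 6 = t ^ 5 * t := by ring
    have h4 : (t : ℝ) ^ 5 = t ^ 4 * t := by ring
    have h40 : (1 : ℝ) ≤ t ^ 4 := one_le_pow₀ (by linarith)
    have h50 : (t : ℝ) ^ 4 * 100 ≤ t ^ 5 := by rw [h4]; gcongr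
    have h60 : (t : ℝ) ^ 5 * 100 ≤ t ^ 6 := by rw [h5]; gcongr
    have : (9 * (t : ℝ) ^ 3) ^ 2 = 81 * t ^ 6 := by ring
    rw [this]
    linarith
  have h3 : (1 : ℝ) ≤ t ^ 3 := one_le_pow₀ (by linarith)
  have h4 : (100 : ℝ) * t ^ 3 ≤ t ^ 4 := by
    rw [pow_succ' (t : ℝ) 3]
    gcongr
  have h5 : (1000000 : ℝ) ≤ t ^ 3 := by
    calc (1000000 : ℝ) = 100 ^ 3 := by norm_num
      _ ≤ _ := by gcongr
  push_cast
  linarith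

/-- There are arbitrarily large `t` with `Ω t = Ω (t + 1)`. -/
theorem exists_cardFactors_eq_succ (N : ℕ) :
    ∃ t, N ≤ t ∧ cardFactors t = cardFactors (t + 1) := by
  by_contra! hne
  obtain ⟨u, hNu, hu100⟩ : ∃ u, N ≤ u ∧ 100 ≤ u := ⟨max N 100, le_max_left _ _, le_max_right _ _⟩
  have hk : 1 ≤ u ^ 4 := Nat.one_le_pow _ _ (by omega)
  have hNk : N ≤ u ^ 4 := hNu.trans (Nat.le_self_pow (by norm_num) u)
  obtain ⟨L, M, x, s, hcard, hLpos, hLle, hforms, hpairs⟩ := exists_linear_forms (u ^ 4) hk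
  obtain ⟨G, hG⟩ : ∃ G, G = 5 * (2 ^ u ^ 4 * (u ^ 4).factorial) ^ 3 := ⟨_, rfl⟩
  rw [← hG] at hLle
  have hG1 : 1 ≤ G := by
    rw [hG]
    exact Nat.one_le_iff_ne_zero.2 (by positivity)
  obtain ⟨z, hz⟩ : ∃ z, z = 2 ^ G := ⟨_, rfl⟩
  rw [← hz] at hLle
  have hz2 : 2 ≤ z := hz ▸ Nat.le_self_pow (by omega) 2
  set T := ((Finset.Icc 1 z).filter Nat.Prime).filter fun p => ¬ p ∣ L with hT
  set S := ∑ p ∈ T, (1 : ℝ) / p with hS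
  have hSle : S ≤ 5 + 4 * Real.log G := by
    refine (Finset.sum_le_sum_of_subset_of_nonneg (Finset.filter_subset _ _)
      fun p _ _ => by positivity).trans ?_
    rw [hz]
    exact sum_inv_prime_le G hG1
  choose! c d hcL hd hdc hcop hprime hΩ using hforms
  set W := √(S + 3) + 9 with hW
  have hdev : ∀ a ∈ s, ∑ y ∈ Finset.range (z ^ 2),
      |(cardFactors (c a * y + d a) : ℝ) - S| ≤ (z : ℝ) ^ 2 * W := by
    intro a ha
    refine sum_abs_cardFactors_sub_le (by omega) (hd a ha) ?_ ?_ ?_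
    · intro y hy
      have h1 : c a ≤ z := (hcL a ha).trans hLle
      have h2 : c a * (y + 1) ≤ z * z ^ 2 := Nat.mul_le_mul h1 hy
      have h3 := hdc a ha
      have h4 : z * 8 ≤ z * z ^ 2 * 2 := by nlinarith
      have h5 : z * z ^ 2 * 2 ≤ z ^ 4 := by
        calc z * z ^ 2 * 2 ≤ z * z ^ 2 * z := Nat.mul_le_mul_left _ hz2
          _ = z ^ 4 := by ring
      nlinarith
    · intro p hp
      rw [hT, Finset.mem_filter, Finset.mem_filter, Finset.mem_Icc] at hp
      refine ⟨hp.1.2, hp.1.1.2, (hp.1.2.coprime_iff_not_dvd).2 fun h => hp.2 ?_⟩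
      exact (hprime a ha p hp.1.2).1 h
    · rintro p hp ⟨y, hy⟩ hpz
      rw [hT, Finset.mem_filter, Finset.mem_filter, Finset.mem_Icc]
      refine ⟨⟨⟨hp.pos, hpz⟩, hp⟩, fun h => ?_⟩
      have hpc := (hprime a ha p hp).2 h
      have hpd := (Nat.dvd_add_right (hpc.mul_right y)).1 hy
      exact hp.one_lt.ne' (Nat.dvd_one.1 ((hcop a ha) ▸ Nat.dvd_gcd hpc hpd))
  obtain ⟨y, -, hy⟩ : ∃ y ∈ Finset.range (z ^ 2),
      ∑ a ∈ s, |(cardFactors (c a * y + d a) : ℝ) - S| ≤ s.card * W := by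
    refine Finset.exists_le_of_sum_le ⟨0, Finset.mem_range.2 (by positivity)⟩ ?_
    rw [Finset.sum_comm]
    refine (Finset.sum_le_sum hdev).trans (le_of_eq ?_)
    simp only [Finset.sum_const, Finset.card_range, nsmul_eq_mul]
    push_cast
    ring
  have hlt : ∀ a ∈ s, ∀ b ∈ s, a < b →
      cardFactors (c a * y + d a) ≠ cardFactors (c b * y + d b) := by
    intro a ha b hb hab h
    obtain ⟨⟨t, ht⟩, hle⟩ := hpairs a ha b hb hab y
    have hpos : 0 < b - a := by omega
    have hkt : u ^ 4 ≤ t := by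
      rw [ht, mul_comm] at hle
      exact Nat.le_of_mul_le_mul_left hle hpos
    refine hne t (hNk.trans hkt) ?_
    have ht' : x + L * y + b = (b - a) * (t + 1) := by
      rw [mul_add, ← ht]
      omega
    have h1 := hΩ a ha y
    have h2 := hΩ b hb y
    rw [ht, cardFactors_mul hpos.ne' (by omega)] at h1
    rw [ht', cardFactors_mul hpos.ne' (by omega)] at h2
    omega
  have hinj : Set.InjOn (fun a => cardFactors (c a * y + d a)) s := by
    intro a ha b hb hab
    by_contra hne'
    rcases lt_or_gt_of_ne hne' with h | h
    · exact hlt a ha b hb h hab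
    · exact hlt b hb a ha h hab.symm
  have hfinal := card_le_of_sum_abs_sub_le (by positivity) hinj hy
  rw [hcard] at hfinal
  rw [hG] at hSle
  exact (two_mul_sqrt_add_lt hu100 hSle).not_ge hfinal

/-- For every positive integer `n`, there are infinitely many positive integers `x`
with `Ω(x) = Ω(x + n)`. -/
theorem stmt_8 (n : ℕ) (hn : 0 < n) :
    {x : ℕ | 0 < x ∧ x.primeFactorsList.length = (x + n).primeFactorsList.length}.Infinite := by
  refine Set.infinite_of_forall_exists_gt fun N => ?_
  obtain ⟨t, ht, h⟩ := exists_cardFactors_eq_succ (N + 1)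
  refine ⟨n * t, ⟨Nat.mul_pos hn (by omega), ?_⟩, ?_⟩
  · rw [← cardFactors_apply, ← cardFactors_apply, ← Nat.mul_succ,
      cardFactors_mul hn.ne' (by omega), cardFactors_mul hn.ne' (by omega), h]
  · exact lt_of_lt_of_le ht (Nat.le_mul_of_pos_left t hn)
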